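/- Let A_1, …, A_n be nonempty finite subsets of ℤ^n. If the intersection of the tropical hypersurfaces with zero coefficients satisfies T(A_1, 0) ∩ ⋯ ∩ T(A_n, 0) = {0}, then MV(conv(A_1), …, conv(A_n)) ≠ 0. -/

import Mathlib

open Pointwise MeasureTheory

/-- The dot product on `ℝⁿ`. -/
noncomputable def dotp (n : ℕ) (x y : Fin n → ℝ) : ℝ := ∑ l, x l * y l

/-- The tropical hypersurface (with all coefficients `0`) of a point
configuration `A ⊆ ℝⁿ`: the points `x` where `max_{a ∈ A} ⟪a, x⟫` is attained
at at least two distinct points of `A`. -/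
def tropHS (n : ℕ) (A : Set (Fin n → ℝ)) : Set (Fin n → ℝ) :=
  {x | ∃ a ∈ A, ∃ b ∈ A, a ≠ b ∧
    (∀ c ∈ A, dotp n c x ≤ dotp n a x) ∧ dotp n a x = dotp n b x}

/-- The mixed volume of `n` compact convex bodies in `ℝⁿ`, via
inclusion–exclusion on volumes of Minkowski sums. -/
noncomputable def mixedVol (n : ℕ) (C : Fin n → Set (Fin n → ℝ)) : ℝ :=
  ∑ S : Finset (Fin n), (-1 : ℝ) ^ (n - S.card) * (volume (∑ i ∈ S, C i)).toReal

/-- The polarization of the determinant. -/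
noncomputable def mixedDet {n : ℕ} (H : Fin n → Matrix (Fin n) (Fin n) ℝ) : ℝ :=
  ∑ S : Finset (Fin n), (-1 : ℝ) ^ (n - S.card) * (∑ i ∈ S, H i).det

lemma sum_filter_subset_neg_one_pow {n : ℕ} (R : Finset (Fin n)) :
    ∑ S : Finset (Fin n), (if R ⊆ S then (-1 : ℝ) ^ (n - S.card) else 0) =
      if R = Finset.univ then 1 else 0 := by
  rw [← Equiv.sum_comp (Function.Involutive.toPerm compl (compl_involutive (α := Finset (Fin n))))]
  have h1 : ∀ U : Finset (Fin n), (if R ⊆ Uᶜ then (-1 : ℝ) ^ (n - Uᶜ.card) else 0) =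
      if U ∈ Rᶜ.powerset then (-1 : ℝ) ^ U.card else 0 := by
    intro U
    have : U.card ≤ n := by simpa using Finset.card_le_univ U
    simp only [Finset.mem_powerset, Finset.card_compl, Fintype.card_fin,
      Nat.sub_sub_self this, Finset.subset_compl_comm (s := U)]
  rw [Function.Involutive.coe_toPerm, Finset.sum_congr rfl fun U _ => h1 U, Finset.sum_ite_mem,
    Finset.univ_inter]
  have := Finset.sum_powerset_neg_one_pow_card (x := Rᶜ)
  have h2 := congrArg (fun z : ℤ => (z : ℝ)) this
  push_cast at h2
  rw [h2]
  simp [Finset.compl_eq_empty_iff]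

lemma mixedDet_eq_sum_perm {n : ℕ} (H : Fin n → Matrix (Fin n) (Fin n) ℝ) :
    mixedDet H = ∑ σ : Equiv.Perm (Fin n), (Matrix.of fun l => H (σ l) l).det := by
  have h1 : ∀ S : Finset (Fin n), (∑ i ∈ S, H i).det =
      ∑ r : Fin n → Fin n, if Finset.univ.image r ⊆ S then
        (Matrix.of fun l => H (r l) l).det else 0 := by
    intro S
    have h2 : (∑ i ∈ S, H i) = Matrix.of fun l => ∑ i ∈ S, H i l := by
      ext l m
      simp [Matrix.sum_apply]
    have h3 := (Matrix.detRowAlternating (n := Fin n) (R := ℝ)).toMultilinearMap.map_sum_finset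
      (fun l i => H i l) (fun _ => S)
    rw [h2]
    refine h3.trans ?_
    rw [← Finset.sum_filter]
    refine Finset.sum_congr ?_ fun _ _ => rfl
    ext r
    simp [Fintype.mem_piFinset, Finset.image_subset_iff]
  unfold mixedDet
  simp_rw [h1, Finset.mul_sum]
  rw [Finset.sum_comm]
  have h4 : ∀ r : Fin n → Fin n, (∑ S : Finset (Fin n), (-1 : ℝ) ^ (n - S.card) *
      (if Finset.univ.image r ⊆ S then (Matrix.of fun l => H (r l) l).det else 0)) =
      if Function.Bijective r then (Matrix.of fun l => H (r l) l).det else 0 := by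
    intro r
    have h5 := congrArg (· * (Matrix.of fun l => H (r l) l).det)
      (sum_filter_subset_neg_one_pow (Finset.univ.image r))
    simp only [Finset.sum_mul, ite_mul, zero_mul, one_mul] at h5
    simp only [mul_ite, mul_zero]
    rw [h5]
    refine if_congr ?_ rfl rfl
    rw [← Finite.surjective_iff_bijective, ← Finset.coe_inj, Finset.coe_image, Finset.coe_univ,
      Set.image_univ, Set.range_eq_univ]
  rw [Finset.sum_congr rfl fun r _ => h4 r, ← Finset.sum_filter]
  symm
  refine Finset.sum_bij (fun σ _ => ⇑σ)
    (fun σ _ => Finset.mem_filter.2 ⟨Finset.mem_univ _, σ.bijective⟩)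
    (fun _ _ _ _ h => DFunLike.coe_injective h) ?_ fun _ _ => rfl
  intro r hr
  exact ⟨Equiv.ofBijective r (Finset.mem_filter.1 hr).2, Finset.mem_univ _, rfl⟩

lemma mixedDet_sum_vecMulVec {n : ℕ} {τ : Type*} [DecidableEq τ] (T : Fin n → Finset τ)
    (w : Fin n → τ → ℝ) (u : Fin n → τ → Fin n → ℝ) :
    mixedDet (fun i => ∑ t ∈ T i, w i t • Matrix.vecMulVec (u i t) (u i t)) =
      ∑ f ∈ Fintype.piFinset T,
        (∏ i, w i (f i)) * (Matrix.of fun i => u i (f i)).det ^ 2 := by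
  rw [mixedDet_eq_sum_perm, ← Equiv.sum_comp (Equiv.inv (Equiv.Perm (Fin n)))]
  have h1 : ∀ σ : Equiv.Perm (Fin n), (Matrix.of fun l =>
      (∑ t ∈ T (σ⁻¹ l), w (σ⁻¹ l) t •
        Matrix.vecMulVec (u (σ⁻¹ l) t) (u (σ⁻¹ l) t) : Matrix (Fin n) (Fin n) ℝ) l).det =
      ∑ f ∈ Fintype.piFinset T, ((∏ i, w i (f i)) * (Matrix.of fun i => u i (f i)).det) *
        (((Equiv.Perm.sign σ : ℤ) : ℝ) * ∏ i, u i (f i) (σ i)) := by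
    intro σ
    have h2 := Matrix.det_permute σ (Matrix.of fun l =>
      (∑ t ∈ T (σ⁻¹ l), w (σ⁻¹ l) t •
        Matrix.vecMulVec (u (σ⁻¹ l) t) (u (σ⁻¹ l) t) : Matrix (Fin n) (Fin n) ℝ) l)
    have h3 : ((Matrix.of fun l => (∑ t ∈ T (σ⁻¹ l), w (σ⁻¹ l) t •
        Matrix.vecMulVec (u (σ⁻¹ l) t) (u (σ⁻¹ l) t) : Matrix (Fin n) (Fin n) ℝ) l).submatrix
          σ id) = Matrix.of fun i => ∑ t ∈ T i, (w i t * u i t (σ i)) • u i t := by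
      ext i m
      simp [Matrix.sum_apply, Matrix.vecMulVec_apply, mul_assoc]
    rw [h3] at h2
    have h4 := (Matrix.detRowAlternating (n := Fin n) (R := ℝ)).toMultilinearMap.map_sum_finset
      (fun i t => (w i t * u i t (σ i)) • u i t) T
    have h5 : (Matrix.of fun i => ∑ t ∈ T i, (w i t * u i t (σ i)) • u i t).det =
        ∑ f ∈ Fintype.piFinset T, (∏ i, (w i (f i) * u i (f i) (σ i))) *
          (Matrix.of fun i => u i (f i)).det := by
      refine h4.trans (Finset.sum_congr rfl fun f _ => ?_)
      exact (MultilinearMap.map_smul_univ _ _ _).trans (by rw [smul_eq_mul]; rfl)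
    rw [h5] at h2
    have h6 : ((Equiv.Perm.sign σ : ℤ) : ℝ) * ((Equiv.Perm.sign σ : ℤ) : ℝ) = 1 := by
      rw [← Int.cast_mul]
      simp
    have h7 := congrArg (((Equiv.Perm.sign σ : ℤ) : ℝ) * ·) h2
    simp only [← mul_assoc, h6, one_mul] at h7
    rw [← h7, Finset.mul_sum]
    refine Finset.sum_congr rfl fun f _ => ?_
    rw [Finset.prod_mul_distrib]
    ring
  simp only [Equiv.inv_apply]
  rw [Finset.sum_congr rfl fun σ _ => h1 σ, Finset.sum_comm]
  refine Finset.sum_congr rfl fun f _ => ?_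
  rw [← Finset.mul_sum]
  have h8 : ∑ σ : Equiv.Perm (Fin n), ((Equiv.Perm.sign σ : ℤ) : ℝ) * ∏ i, u i (f i) (σ i) =
      (Matrix.of fun i => u i (f i)).det := by
    rw [← Matrix.det_transpose, Matrix.det_apply']
    simp
  rw [h8]
  ring

lemma exists_mem_forall_notMem {V : Type*} [AddCommGroup V] [Module ℝ V] {ι : Type*} [Finite ι]
    (L : Submodule ℝ V) (M : ι → Submodule ℝ V) (h : ∀ i, ¬ L ≤ M i) :
    ∃ x ∈ L, ∀ i, x ∉ M i := by
  by_contra! hcon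
  have h1 : ⋃ i, (((M i).comap L.subtype : Submodule ℝ L) : Set L) = Set.univ := by
    refine Set.eq_univ_of_forall fun x => ?_
    obtain ⟨i, hi⟩ := hcon x x.2
    exact Set.mem_iUnion.2 ⟨i, hi⟩
  obtain ⟨i, hi⟩ := Subspace.exists_eq_top_of_iUnion_eq_univ h1
  exact h i (Submodule.comap_subtype_eq_top.1 hi)

/-- Rado's theorem for subspaces of a real vector space. -/
lemma exists_linearIndependent_transversal {V ι : Type*} [AddCommGroup V] [Module ℝ V]
    [FiniteDimensional ℝ V] [Fintype ι] [DecidableEq ι] (L : ι → Submodule ℝ V)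
    (h : ∀ K : Finset ι, K.card ≤ Module.finrank ℝ ↥(⨆ i ∈ K, L i)) :
    ∃ v : ι → V, (∀ i, v i ∈ L i) ∧ LinearIndependent ℝ v := by
  have key : ∀ s : Finset ι, ∃ v : ι → V, (∀ i ∈ s, v i ∈ L i) ∧ ∀ K : Finset ι,
      K.card ≤ Module.finrank ℝ ↥(⨆ i ∈ K, if i ∈ s then Submodule.span ℝ {v i} else L i) := by
    intro s
    induction s using Finset.induction_on with
    | empty => exact ⟨fun _ => 0, by simp, h⟩
    | insert j s hj ih =>
      obtain ⟨v, hv, hK⟩ := ih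
      set M : ι → Submodule ℝ V := fun i => if i ∈ s then Submodule.span ℝ {v i} else L i with hM
      have hMj : M j = L j := by simp [hM, hj]
      let τ := {K : Finset ι // j ∉ K ∧ K.card = Module.finrank ℝ ↥(⨆ i ∈ K, M i)}
      obtain ⟨x, hxL, hx⟩ := exists_mem_forall_notMem (ι := τ) (L j)
        (fun K => ⨆ i ∈ K.1, M i) (by
          rintro ⟨K, hjK, hc⟩ hle
          have h1 := hK (insert j K)
          rw [Finset.card_insert_of_notMem hjK, Finset.iSup_insert] at h1
          have h2 : M j ⊔ ⨆ i ∈ K, M i = ⨆ i ∈ K, M i := by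
            rw [hMj]
            exact sup_eq_right.2 hle
          change _ ≤ Module.finrank ℝ ↥(M j ⊔ ⨆ i ∈ K, M i) at h1
          rw [h2] at h1
          omega)
      refine ⟨Function.update v j x, ?_, ?_⟩
      · intro i hi
        rcases Finset.mem_insert.1 hi with rfl | hi
        · simpa using hxL
        · have : i ≠ j := fun h => hj (h ▸ hi)
          simpa [this] using hv i hi
      · intro K
        have hne : ∀ i, i ≠ j → (if i ∈ insert j s then
            Submodule.span ℝ {Function.update v j x i} else L i) = M i := by
          intro i hi
          simp [hM, hi]
        by_cases hjK : j ∈ K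
        · have h3 : K = insert j (K.erase j) := (Finset.insert_erase hjK).symm
          rw [h3, Finset.card_insert_of_notMem (Finset.notMem_erase j K), Finset.iSup_insert]
          have h4 : (⨆ i ∈ K.erase j, if i ∈ insert j s then
              Submodule.span ℝ {Function.update v j x i} else L i) = ⨆ i ∈ K.erase j, M i :=
            iSup_congr fun i => iSup_congr fun hi => hne i (Finset.ne_of_mem_erase hi)
          rw [h4]
          rw [if_pos (Finset.mem_insert_self j s), Function.update_self]
          rcases (hK (K.erase j)).eq_or_lt with heq | hlt
          · change (K.erase j).card = Module.finrank ℝ ↥(⨆ i ∈ K.erase j, M i) at heq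
            have h5 := hx ⟨K.erase j, Finset.notMem_erase j K, heq⟩
            have h6 : (⨆ i ∈ K.erase j, M i) < Submodule.span ℝ {x} ⊔ ⨆ i ∈ K.erase j, M i := by
              refine lt_of_le_of_ne le_sup_right fun h7 => h5 ?_
              change x ∈ ⨆ i ∈ K.erase j, M i
              rw [h7]
              exact (le_sup_left : Submodule.span ℝ {x} ≤ _) (Submodule.mem_span_singleton_self x)
            have := Submodule.finrank_lt_finrank_of_lt h6
            omega
          · have : Module.finrank ℝ ↥(⨆ i ∈ K.erase j, M i) ≤
                Module.finrank ℝ ↥(Submodule.span ℝ {x} ⊔ ⨆ i ∈ K.erase j, M i) :=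
              Submodule.finrank_mono le_sup_right
            exact hlt.trans_le this
        · have h4 : (⨆ i ∈ K, if i ∈ insert j s then
              Submodule.span ℝ {Function.update v j x i} else L i) = ⨆ i ∈ K, M i :=
            iSup_congr fun i => iSup_congr fun hi => hne i (fun h => hjK (h ▸ hi))
          rw [h4]
          exact hK K
  obtain ⟨v, hv, hK⟩ := key Finset.univ
  refine ⟨v, fun i => hv i (Finset.mem_univ i), ?_⟩
  rw [linearIndependent_iff_card_eq_finrank_span]
  refine le_antisymm ?_ (finrank_range_le_card v)
  have := hK Finset.univ
  have h8 : (⨆ i ∈ (Finset.univ : Finset ι), if i ∈ (Finset.univ : Finset ι) then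
      Submodule.span ℝ {v i} else L i) = Submodule.span ℝ (Set.range v) := by
    simp [Submodule.span_range_eq_iSup]
  rwa [h8] at this

/-- A determinant that is nonzero on a transversal of spans is nonzero on a transversal of the
generating sets. -/
lemma exists_det_ne_zero_of_mem_span {n : ℕ} (D : Fin n → Set (Fin n → ℝ)) (v : Fin n → Fin n → ℝ)
    (hv : ∀ i, v i ∈ Submodule.span ℝ (D i)) (hdet : (Matrix.of v).det ≠ 0) :
    ∃ u : Fin n → Fin n → ℝ, (∀ i, u i ∈ D i) ∧ (Matrix.of u).det ≠ 0 := by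
  have key : ∀ s : Finset (Fin n), ∃ u : Fin n → Fin n → ℝ, (∀ i ∈ s, u i ∈ D i) ∧
      (∀ i, i ∉ s → u i = v i) ∧ (Matrix.of u).det ≠ 0 := by
    intro s
    induction s using Finset.induction_on with
    | empty => exact ⟨v, by simp, by simp, hdet⟩
    | insert j s hj ih =>
      obtain ⟨u, hu, huv, hud⟩ := ih
      let φ : (Fin n → ℝ) →ₗ[ℝ] ℝ :=
        (Matrix.detRowAlternating (n := Fin n) (R := ℝ)).toMultilinearMap.toLinearMap u j
      have hφ : ∀ x, φ x = (Matrix.of (Function.update u j x)).det := fun x => rfl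
      have h1 : ∃ d ∈ D j, φ d ≠ 0 := by
        by_contra! hcon
        have h2 : Submodule.span ℝ (D j) ≤ LinearMap.ker φ :=
          Submodule.span_le.2 fun d hd => hcon d hd
        have h3 : φ (v j) = 0 := h2 (hv j)
        rw [hφ, ← huv j hj, Function.update_eq_self] at h3
        exact hud h3
      obtain ⟨d, hd, hd0⟩ := h1
      refine ⟨Function.update u j d, ?_, ?_, by rwa [hφ] at hd0⟩
      · intro i hi
        rcases Finset.mem_insert.1 hi with rfl | hi
        · simpa using hd
        · have : i ≠ j := fun h => hj (h ▸ hi)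
          simpa [this] using hu i hi
      · intro i hi
        rw [Finset.mem_insert, not_or] at hi
        simpa [hi.1] using huv i hi.2
  obtain ⟨u, hu, -, hud⟩ := key Finset.univ
  exact ⟨u, fun i => hu i (Finset.mem_univ i), hud⟩

lemma det_of_ne_zero_iff {n : ℕ} (v : Fin n → Fin n → ℝ) :
    (Matrix.of v).det ≠ 0 ↔ LinearIndependent ℝ v := by
  rw [← isUnit_iff_ne_zero, ← Matrix.isUnit_iff_isUnit_det,
    ← Matrix.linearIndependent_rows_iff_isUnit]
  rfl

/-- If subspaces of `ℝⁿ` have no independent transversal, then there is a critical set `I` of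
indices, whose members span a subspace of dimension `|I'|` for some proper `I' ⊂ I`, and an
independent family taking its values in this subspace on `I'` and in the given ones outside `I`. -/
lemma exists_deficient_transversal {n : ℕ} (L : Fin n → Submodule ℝ (Fin n → ℝ))
    (h : ¬ ∃ v : Fin n → Fin n → ℝ, (∀ i, v i ∈ L i) ∧ LinearIndependent ℝ v) :
    ∃ (I I' : Finset (Fin n)) (i₀ : Fin n) (v : Fin n → Fin n → ℝ), i₀ ∈ I ∧ i₀ ∉ I' ∧ I' ⊆ I ∧
      LinearIndependent ℝ v ∧ (∀ i ∉ I, v i ∈ L i) ∧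
      ∀ i ∈ I, L i ≤ Submodule.span ℝ (v '' I') := by
  have h0 : ∃ K : Finset (Fin n), Module.finrank ℝ ↥(⨆ i ∈ K, L i) < K.card := by
    by_contra! hcon
    exact h (exists_linearIndependent_transversal L hcon)
  obtain ⟨K₀, hK₀⟩ := h0
  obtain ⟨I, -, hI⟩ := Finset.exists_min_image (Finset.univ : Finset (Finset (Fin n)))
    (fun K => (Module.finrank ℝ ↥(⨆ i ∈ K, L i) : ℤ) - K.card) ⟨K₀, Finset.mem_univ _⟩
  have hlt : Module.finrank ℝ ↥(⨆ i ∈ I, L i) < I.card := by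
    have := hI K₀ (Finset.mem_univ _)
    omega
  set W : Submodule ℝ (Fin n → ℝ) := ⨆ i ∈ I, L i with hW
  obtain ⟨I', hI'I, hI'⟩ := Finset.exists_subset_card_eq hlt.le
  obtain ⟨i₀, hi₀, hi₀'⟩ : ∃ i₀ ∈ I, i₀ ∉ I' := by
    by_contra! hcon
    have := Finset.card_le_card (show I ⊆ I' from hcon)
    omega
  have hext : ∀ K : Finset (Fin n), Disjoint I K →
      Module.finrank ℝ W + K.card ≤ Module.finrank ℝ ↥(W ⊔ ⨆ i ∈ K, L i) := by
    intro K hK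
    have h1 := hI (I ∪ K) (Finset.mem_univ _)
    rw [Finset.card_union_of_disjoint hK, Finset.iSup_union, ← hW] at h1
    omega
  let L' : Fin n → Submodule ℝ (Fin n → ℝ) := fun i =>
    if i ∈ I' then W else if i ∈ I then ⊤ else L i
  have hL' : ∀ K : Finset (Fin n), K.card ≤ Module.finrank ℝ ↥(⨆ i ∈ K, L' i) := by
    intro K
    by_cases htop : ∃ i ∈ K, i ∈ I ∧ i ∉ I'
    · obtain ⟨i, hiK, hiI, hiI'⟩ := htop
      have h1 : (⨆ i ∈ K, L' i) = ⊤ := by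
        refine top_unique (le_trans (le_of_eq ?_) (le_iSup₂_of_le i hiK le_rfl))
        simp [L', hiI, hiI']
      rw [h1, finrank_top]
      simpa using Finset.card_le_univ K
    · push Not at htop
      have h2 : (⨆ i ∈ K \ I, L i) ≤ ⨆ i ∈ K, L' i := by
        refine iSup₂_le fun i hi => ?_
        rw [Finset.mem_sdiff] at hi
        refine le_trans (le_of_eq ?_) (le_iSup₂_of_le i hi.1 le_rfl)
        have : i ∉ I' := fun h => hi.2 (hI'I h)
        simp [L', hi.2, this]
      have h3 := hext (K \ I) Finset.disjoint_sdiff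
      have h4 : (K ∩ I).card + (K \ I).card = K.card := Finset.card_inter_add_card_sdiff K I
      by_cases hKI : (K ∩ I).Nonempty
      · obtain ⟨i, hi⟩ := hKI
        rw [Finset.mem_inter] at hi
        have h5 : W ≤ ⨆ i ∈ K, L' i := by
          refine le_trans (le_of_eq ?_) (le_iSup₂_of_le i hi.1 le_rfl)
          simp [L', htop i hi.1 hi.2]
        have h6 := Submodule.finrank_mono (sup_le h5 h2)
        have h7 : (K ∩ I).card ≤ I'.card := Finset.card_le_card fun i hi => by
          rw [Finset.mem_inter] at hi
          exact htop i hi.1 hi.2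
        omega
      · rw [Finset.not_nonempty_iff_eq_empty] at hKI
        rw [hKI, Finset.card_empty] at h4
        have h6 := Submodule.finrank_mono h2
        have h7 := Submodule.finrank_add_le_finrank_add_finrank W (⨆ i ∈ K \ I, L i)
        omega
  obtain ⟨v, hv, hli⟩ := exists_linearIndependent_transversal L' hL'
  refine ⟨I, I', i₀, v, hi₀, hi₀', hI'I, hli, ?_, ?_⟩
  · intro i hi
    have : i ∉ I' := fun h => hi (hI'I h)
    simpa [L', hi, this] using hv i
  · have h1 : Submodule.span ℝ (v '' I') ≤ W := by
      rw [Submodule.span_le]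
      rintro _ ⟨i, hi, rfl⟩
      have := hv i
      simpa [L', Finset.mem_coe.1 hi] using this
    have h2 : Module.finrank ℝ ↥(Submodule.span ℝ (v '' I')) = I'.card := by
      have h3 : LinearIndependent ℝ (fun i : I' => v i) :=
        hli.comp (fun i : I' => (i : Fin n)) Subtype.val_injective
      have h4 := finrank_span_eq_card h3
      rw [Fintype.card_coe] at h4
      have h5 : Set.range (fun i : I' => v i) = v '' I' := by
        ext
        simp
      rw [← h4, h5]
    have h3 := Submodule.eq_of_le_of_finrank_eq h1 (by rw [h2, hI'])
    intro i hi
    rw [h3, hW]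
    exact le_iSup₂_of_le i hi le_rfl

/-- The linear functional `x ↦ a ⬝ᵥ x`. -/
noncomputable def dotCLM {n : ℕ} (a : Fin n → ℝ) : (Fin n → ℝ) →L[ℝ] ℝ :=
  ∑ l, a l • ContinuousLinearMap.proj l

lemma dotCLM_apply {n : ℕ} (a x : Fin n → ℝ) : dotCLM a x = a ⬝ᵥ x := by
  simp [dotCLM, dotProduct]

lemma continuous_dotProduct_left {n : ℕ} (a : Fin n → ℝ) :
    Continuous fun x : Fin n → ℝ => a ⬝ᵥ x := by
  simpa only [funext (dotCLM_apply a)] using (dotCLM a).continuous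

lemma hasFDerivAt_dotProduct {n : ℕ} (a x : Fin n → ℝ) :
    HasFDerivAt (fun x : Fin n → ℝ => a ⬝ᵥ x) (dotCLM a) x := by
  simpa only [funext (dotCLM_apply a)] using (dotCLM a).hasFDerivAt (x := x)

section Gibbs

open scoped Matrix

variable {n : ℕ} (s : Finset (Fin n → ℝ)) (c : (Fin n → ℝ) → ℝ)

/-- The exponential sum with support `s` and coefficients `c`. -/
noncomputable def expSum (x : Fin n → ℝ) : ℝ := ∑ a ∈ s, c a * Real.exp (a ⬝ᵥ x)

/-- The Gibbs weight of the exponent `a` at `x`. -/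
noncomputable def gibbs (x a : Fin n → ℝ) : ℝ := c a * Real.exp (a ⬝ᵥ x) / expSum s c x

/-- The gradient of `log (expSum s c)`, the barycenter of `s` for the Gibbs weights. -/
noncomputable def momentMap (x : Fin n → ℝ) : Fin n → ℝ := ∑ a ∈ s, gibbs s c x a • a

/-- The weight of a pair of exponents in the covariance of the Gibbs weights. -/
noncomputable def pairWeight (x : Fin n → ℝ) (t : (Fin n → ℝ) × (Fin n → ℝ)) : ℝ :=
  gibbs s c x t.1 * gibbs s c x t.2 / 2

/-- The Hessian of `log (expSum s c)`, the covariance matrix of the Gibbs weights. -/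
noncomputable def gibbsHess (x : Fin n → ℝ) : Matrix (Fin n) (Fin n) ℝ :=
  ∑ t ∈ s ×ˢ s, pairWeight s c x t • Matrix.vecMulVec (t.1 - t.2) (t.1 - t.2)

variable {s c}

lemma expSum_pos (hs : s.Nonempty) (hc : ∀ a, 0 < c a) (x : Fin n → ℝ) : 0 < expSum s c x :=
  Finset.sum_pos (fun a _ => mul_pos (hc a) (Real.exp_pos _)) hs

lemma gibbs_pos (hs : s.Nonempty) (hc : ∀ a, 0 < c a) (x a : Fin n → ℝ) : 0 < gibbs s c x a :=
  div_pos (mul_pos (hc a) (Real.exp_pos _)) (expSum_pos hs hc x)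

lemma pairWeight_pos (hs : s.Nonempty) (hc : ∀ a, 0 < c a) (x : Fin n → ℝ)
    (t : (Fin n → ℝ) × (Fin n → ℝ)) : 0 < pairWeight s c x t :=
  half_pos (mul_pos (gibbs_pos hs hc x _) (gibbs_pos hs hc x _))

lemma sum_gibbs (hs : s.Nonempty) (hc : ∀ a, 0 < c a) (x : Fin n → ℝ) :
    ∑ a ∈ s, gibbs s c x a = 1 := by
  simp only [gibbs]
  rw [← Finset.sum_div]
  exact div_self (expSum_pos hs hc x).ne'

lemma gibbs_le_one (hs : s.Nonempty) (hc : ∀ a, 0 < c a) (x : Fin n → ℝ) {a : Fin n → ℝ}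
    (ha : a ∈ s) : gibbs s c x a ≤ 1 := by
  rw [← sum_gibbs hs hc x]
  exact Finset.single_le_sum (f := gibbs s c x) (fun b _ => (gibbs_pos hs hc x b).le) ha

lemma gibbs_le_div (hc : ∀ a, 0 < c a) (x a : Fin n → ℝ) {b : Fin n → ℝ}
    (hb : b ∈ s) : gibbs s c x a ≤ c a / c b * Real.exp (a ⬝ᵥ x - b ⬝ᵥ x) := by
  have h1 : c b * Real.exp (b ⬝ᵥ x) ≤ expSum s c x :=
    Finset.single_le_sum (f := fun b => c b * Real.exp (b ⬝ᵥ x))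
      (fun b _ => (mul_pos (hc b) (Real.exp_pos _)).le) hb
  calc gibbs s c x a ≤ c a * Real.exp (a ⬝ᵥ x) / (c b * Real.exp (b ⬝ᵥ x)) :=
        div_le_div_of_nonneg_left (mul_pos (hc a) (Real.exp_pos _)).le
          (mul_pos (hc b) (Real.exp_pos _)) h1
    _ = _ := by rw [Real.exp_sub]; ring

lemma continuous_expSum : Continuous (expSum s c) := by
  unfold expSum
  exact continuous_finsetSum _ fun a _ =>
    continuous_const.mul (Real.continuous_exp.comp (continuous_dotProduct_left a))

lemma continuous_gibbs (hs : s.Nonempty) (hc : ∀ a, 0 < c a) (a : Fin n → ℝ) :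
    Continuous fun x => gibbs s c x a :=
  (continuous_const.mul (Real.continuous_exp.comp (continuous_dotProduct_left a))).div
    continuous_expSum fun x => (expSum_pos hs hc x).ne'

lemma continuous_pairWeight (hs : s.Nonempty) (hc : ∀ a, 0 < c a)
    (t : (Fin n → ℝ) × (Fin n → ℝ)) : Continuous fun x => pairWeight s c x t :=
  ((continuous_gibbs hs hc _).mul (continuous_gibbs hs hc _)).div_const 2

lemma continuous_gibbsHess (hs : s.Nonempty) (hc : ∀ a, 0 < c a) :
    Continuous (gibbsHess s c) := by
  unfold gibbsHess
  exact continuous_finsetSum _ fun t _ => (continuous_pairWeight hs hc t).smul continuous_const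

lemma posSemidef_gibbsHess (hs : s.Nonempty) (hc : ∀ a, 0 < c a) (x : Fin n → ℝ) :
    (gibbsHess s c x).PosSemidef :=
  Matrix.posSemidef_sum _ fun t _ =>
    (Matrix.posSemidef_vecMulVec_self_star (t.1 - t.2)).smul (pairWeight_pos hs hc x t).le

lemma gibbsHess_mulVec (x v : Fin n → ℝ) : gibbsHess s c x *ᵥ v =
    ∑ t ∈ s ×ˢ s, (pairWeight s c x t * ((t.1 - t.2) ⬝ᵥ v)) • (t.1 - t.2) := by
  unfold gibbsHess
  rw [Matrix.sum_mulVec]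
  refine Finset.sum_congr rfl fun t _ => ?_
  rw [Matrix.smul_mulVec, Matrix.vecMulVec_mulVec, mul_smul, op_smul_eq_smul]

lemma dotProduct_gibbsHess_mulVec (x v : Fin n → ℝ) : v ⬝ᵥ (gibbsHess s c x *ᵥ v) =
    ∑ t ∈ s ×ˢ s, pairWeight s c x t * ((t.1 - t.2) ⬝ᵥ v) ^ 2 := by
  rw [gibbsHess_mulVec, dotProduct_sum]
  refine Finset.sum_congr rfl fun t _ => ?_
  rw [dotProduct_smul, dotProduct_comm v, smul_eq_mul]
  ring

lemma sum_pair_eq_covariance {ι : Type*} (s : Finset ι) (p α β : ι → ℝ) (hp : ∑ a ∈ s, p a = 1) :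
    ∑ t ∈ s ×ˢ s, p t.1 * p t.2 / 2 * (α t.1 - α t.2) * (β t.1 - β t.2) =
      ∑ a ∈ s, p a * α a * β a - (∑ a ∈ s, p a * α a) * ∑ a ∈ s, p a * β a := by
  have h1 : ∀ a b, p a * p b / 2 * (α a - α b) * (β a - β b) =
      2⁻¹ * (p a * α a * β a * p b) + 2⁻¹ * (p a * (p b * α b * β b)) -
        2⁻¹ * (p a * α a * (p b * β b)) - 2⁻¹ * (p a * β a * (p b * α b)) := by
    intro a b
    ring
  rw [Finset.sum_product]
  simp only [h1, Finset.sum_sub_distrib, Finset.sum_add_distrib, ← Finset.mul_sum,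
    ← Finset.sum_mul, hp]
  ring

lemma hasFDerivAt_expSum (x : Fin n → ℝ) : HasFDerivAt (expSum s c)
    (∑ a ∈ s, (c a * Real.exp (a ⬝ᵥ x)) • dotCLM a) x := by
  unfold expSum
  refine HasFDerivAt.fun_sum fun a _ => ?_
  have := ((hasFDerivAt_dotProduct a x).exp).const_mul (c a)
  rwa [smul_smul] at this

lemma hasFDerivAt_log_expSum (hs : s.Nonempty) (hc : ∀ a, 0 < c a) (x : Fin n → ℝ) :
    HasFDerivAt (fun x => Real.log (expSum s c x)) (dotCLM (momentMap s c x)) x := by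
  refine ((hasFDerivAt_expSum x).log (expSum_pos hs hc x).ne').congr_fderiv ?_
  ext1 v
  simp only [dotCLM_apply, momentMap, sum_dotProduct, smul_dotProduct, gibbs,
    smul_apply, sum_apply, Finset.smul_sum, smul_eq_mul]
  refine Finset.sum_congr rfl fun a _ => ?_
  ring

lemma hasFDerivAt_gibbs (hs : s.Nonempty) (hc : ∀ a, 0 < c a) (x a : Fin n → ℝ) :
    HasFDerivAt (fun x => gibbs s c x a)
      (gibbs s c x a • (dotCLM a - dotCLM (momentMap s c x))) x := by
  have hZ := expSum_pos hs hc
  have h1 : ∀ y, gibbs s c y a = c a * Real.exp (a ⬝ᵥ y - Real.log (expSum s c y)) := by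
    intro y
    rw [Real.exp_sub, Real.exp_log (hZ y), gibbs]
    ring
  simp only [h1]
  have := (((hasFDerivAt_dotProduct a x).sub (hasFDerivAt_log_expSum hs hc x)).exp).const_mul (c a)
  rw [smul_smul] at this
  exact this

lemma hasFDerivAt_momentMap (hs : s.Nonempty) (hc : ∀ a, 0 < c a) (x : Fin n → ℝ) :
    HasFDerivAt (momentMap s c)
      (LinearMap.toContinuousLinearMap (Matrix.toLin' (gibbsHess s c x))) x := by
  have h1 : HasFDerivAt (momentMap s c) (∑ a ∈ s,
      (gibbs s c x a • (dotCLM a - dotCLM (momentMap s c x))).smulRight a) x := by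
    unfold momentMap
    exact HasFDerivAt.fun_sum fun a _ => (hasFDerivAt_gibbs hs hc x a).smul_const a
  refine h1.congr_fderiv ?_
  symm
  ext1 v
  ext l
  have h2 := sum_pair_eq_covariance s (gibbs s c x) (fun a => a ⬝ᵥ v) (fun a => a l)
    (sum_gibbs hs hc x)
  have h3 : momentMap s c x ⬝ᵥ v = ∑ a ∈ s, gibbs s c x a * (a ⬝ᵥ v) := by
    simp [momentMap, sum_dotProduct]
  rw [LinearMap.coe_toContinuousLinearMap', Matrix.toLin'_apply, gibbsHess_mulVec]
  simp only [Finset.sum_apply, Pi.smul_apply, Pi.sub_apply, smul_eq_mul, sub_dotProduct,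
    sum_apply, ContinuousLinearMap.smulRight_apply,
    smul_apply, sub_apply, dotCLM_apply, pairWeight, h3]
  rw [h2]
  rw [Finset.mul_sum, ← Finset.sum_sub_distrib]
  refine Finset.sum_congr rfl fun a _ => ?_
  ring

lemma momentMap_mem_convexHull (hs : s.Nonempty) (hc : ∀ a, 0 < c a) (x : Fin n → ℝ) :
    momentMap s c x ∈ convexHull ℝ (s : Set (Fin n → ℝ)) :=
  (convex_convexHull ℝ _).sum_mem (fun a _ => (gibbs_pos hs hc x a).le) (sum_gibbs hs hc x)
    fun _ ha => subset_convexHull ℝ _ ha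

/-- The support function of the hull of `s` is at most `log (expSum s c)` up to a constant. -/
lemma exists_le_log_expSum (hs : s.Nonempty) (hc : ∀ a, 0 < c a) : ∃ C : ℝ, ∀ x : Fin n → ℝ,
    ∀ p ∈ convexHull ℝ (s : Set (Fin n → ℝ)), p ⬝ᵥ x ≤ Real.log (expSum s c x) + C := by
  refine ⟨s.sup' hs fun a => -Real.log (c a), fun x p hp => ?_⟩
  have hconv : Convex ℝ {p : Fin n → ℝ | p ⬝ᵥ x ≤ Real.log (expSum s c x) +
      s.sup' hs fun a => -Real.log (c a)} := by
    have : IsLinearMap ℝ fun p : Fin n → ℝ => p ⬝ᵥ x :=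
      ⟨fun a b => add_dotProduct a b x, fun r a => smul_dotProduct r a x⟩
    exact convex_halfSpace_le this _
  refine convexHull_min (fun a ha => ?_) hconv hp
  have h1 : c a * Real.exp (a ⬝ᵥ x) ≤ expSum s c x :=
    Finset.single_le_sum (f := fun b => c b * Real.exp (b ⬝ᵥ x))
      (fun b _ => (mul_pos (hc b) (Real.exp_pos _)).le) ha
  have h2 := Real.log_le_log (mul_pos (hc a) (Real.exp_pos _)) h1
  rw [Real.log_mul (hc a).ne' (Real.exp_pos _).ne', Real.log_exp] at h2
  have h3 := Finset.le_sup' (fun a => -Real.log (c a)) ha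
  simp only [Set.mem_ofPred_eq]
  linarith

end Gibbs

section System

open scoped Matrix

variable {n : ℕ} {B : Fin n → Finset (Fin n → ℝ)} {c : Fin n → (Fin n → ℝ) → ℝ}

lemma posSemidef_sum_gibbsHess (hB : ∀ i, (B i).Nonempty) (hc : ∀ i a, 0 < c i a)
    (S : Finset (Fin n)) (x : Fin n → ℝ) :
    (∑ i ∈ S, gibbsHess (B i) (c i) x).PosSemidef :=
  Matrix.posSemidef_sum _ fun i _ => posSemidef_gibbsHess (hB i) (hc i) x

lemma hasFDerivAt_sum_momentMap (hB : ∀ i, (B i).Nonempty) (hc : ∀ i a, 0 < c i a)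
    (S : Finset (Fin n)) (x : Fin n → ℝ) :
    HasFDerivAt (fun x => ∑ i ∈ S, momentMap (B i) (c i) x)
      (LinearMap.toContinuousLinearMap
        (Matrix.toLin' (∑ i ∈ S, gibbsHess (B i) (c i) x))) x := by
  rw [map_sum, map_sum]
  exact HasFDerivAt.fun_sum fun i _ => hasFDerivAt_momentMap (hB i) (hc i) x

lemma dotProduct_sum_gibbsHess_mulVec_pos (hB : ∀ i, (B i).Nonempty) (hc : ∀ i a, 0 < c i a)
    {S : Finset (Fin n)} {v : Fin n → ℝ} (hv : ∃ i ∈ S, ∃ a ∈ B i, ∃ b ∈ B i, a ⬝ᵥ v ≠ b ⬝ᵥ v)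
    (x : Fin n → ℝ) : 0 < v ⬝ᵥ ((∑ i ∈ S, gibbsHess (B i) (c i) x) *ᵥ v) := by
  obtain ⟨i, hi, a, ha, b, hb, hab⟩ := hv
  rw [Matrix.sum_mulVec, dotProduct_sum]
  simp only [dotProduct_gibbsHess_mulVec]
  have hnn : ∀ j t, 0 ≤ pairWeight (B j) (c j) x t * ((t.1 - t.2) ⬝ᵥ v) ^ 2 := fun j t =>
    mul_nonneg (pairWeight_pos (hB j) (hc j) x t).le (sq_nonneg _)
  refine Finset.sum_pos' (fun j _ => Finset.sum_nonneg fun t _ => hnn j t) ⟨i, hi, ?_⟩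
  refine Finset.sum_pos' (fun t _ => hnn i t) ⟨(a, b), Finset.mk_mem_product ha hb, ?_⟩
  refine mul_pos (pairWeight_pos (hB i) (hc i) x _) (sq_pos_of_ne_zero ?_)
  rw [sub_dotProduct]
  exact sub_ne_zero.2 hab

lemma injective_sum_momentMap (hB : ∀ i, (B i).Nonempty) (hc : ∀ i a, 0 < c i a)
    {S : Finset (Fin n)}
    (hS : ∀ v ≠ 0, ∃ i ∈ S, ∃ a ∈ B i, ∃ b ∈ B i, a ⬝ᵥ v ≠ b ⬝ᵥ v) :
    Function.Injective fun x => ∑ i ∈ S, momentMap (B i) (c i) x := by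
  intro x y hxy
  by_contra hne
  set v := y - x with hv
  have hv0 : v ≠ 0 := sub_ne_zero.2 (Ne.symm hne)
  set g := fun x => ∑ i ∈ S, momentMap (B i) (c i) x with hg
  have hder : ∀ r : ℝ, HasDerivAt (fun r : ℝ => v ⬝ᵥ g (x + r • v))
      (v ⬝ᵥ ((∑ i ∈ S, gibbsHess (B i) (c i) (x + r • v)) *ᵥ v)) r := by
    intro r
    have h1 : HasDerivAt (fun r : ℝ => x + r • v) v r := by
      simpa using ((hasDerivAt_id r).smul_const v).const_add x
    have h2 := (hasFDerivAt_sum_momentMap hB hc S (x + r • v)).comp_hasDerivAt r h1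
    have h3 := (hasFDerivAt_dotProduct v (g (x + r • v))).comp_hasDerivAt r h2
    rw [dotCLM_apply, LinearMap.coe_toContinuousLinearMap', Matrix.toLin'_apply] at h3
    exact h3
  have hmono : StrictMono fun r : ℝ => v ⬝ᵥ g (x + r • v) :=
    strictMono_of_hasDerivAt_pos hder fun r =>
      dotProduct_sum_gibbsHess_mulVec_pos hB hc (hS v hv0) _
  have h4 := hmono (zero_lt_one' ℝ)
  have h5 : x + v = y := by simp [hv]
  simp only [zero_smul, add_zero, one_smul, h5] at h4
  rw [show g x = g y from hxy] at h4
  exact lt_irrefl _ h4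

lemma exists_le_sum_log_expSum (hB : ∀ i, (B i).Nonempty) (hc : ∀ i a, 0 < c i a)
    (S : Finset (Fin n)) : ∃ C : ℝ, ∀ x : Fin n → ℝ,
      ∀ p ∈ ∑ i ∈ S, convexHull ℝ (B i : Set (Fin n → ℝ)),
        p ⬝ᵥ x ≤ ∑ i ∈ S, Real.log (expSum (B i) (c i) x) + C := by
  choose C hC using fun i => exists_le_log_expSum (hB i) (hc i)
  refine ⟨∑ i ∈ S, C i, fun x p hp => ?_⟩
  obtain ⟨q, hq, rfl⟩ := (Set.mem_finsetSum _ _ _).1 hp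
  rw [sum_dotProduct, ← Finset.sum_add_distrib]
  exact Finset.sum_le_sum fun i hi => hC i x _ (hq hi)

/-- The moment map is onto the interior of the Minkowski sum: the tilted potential is coercive, and
the moment map takes the prescribed value at its minimizer. -/
lemma interior_subset_range_sum_momentMap (hB : ∀ i, (B i).Nonempty) (hc : ∀ i a, 0 < c i a)
    (S : Finset (Fin n)) : interior (∑ i ∈ S, convexHull ℝ (B i : Set (Fin n → ℝ))) ⊆
      Set.range fun x => ∑ i ∈ S, momentMap (B i) (c i) x := by
  intro p hp
  obtain ⟨C, hC⟩ := exists_le_sum_log_expSum hB hc S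
  obtain ⟨ε, hε, hball⟩ := Metric.mem_nhds_iff.1 (mem_interior_iff_mem_nhds.1 hp)
  let ψ : (Fin n → ℝ) → ℝ := fun x => ∑ i ∈ S, Real.log (expSum (B i) (c i) x) - p ⬝ᵥ x
  have hψ : ∀ x, HasFDerivAt ψ
      (∑ i ∈ S, dotCLM (momentMap (B i) (c i) x) - dotCLM p) x := fun x =>
    (HasFDerivAt.fun_sum fun i _ => hasFDerivAt_log_expSum (hB i) (hc i) x).sub
      (hasFDerivAt_dotProduct p x)
  have hcoord : ∀ x l (r : ℝ), |r| < ε → r * x l - C ≤ ψ x := by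
    intro x l r hr
    have hmem : p + Pi.single l r ∈ Metric.ball p ε := by
      rw [mem_ball_iff_norm, add_sub_cancel_left, Pi.norm_single]
      exact hr
    have h1 := hC x _ (hball hmem)
    rw [add_dotProduct, single_dotProduct] at h1
    simp only [ψ]
    linarith
  have hlower : ∀ x, ε / 2 * ‖x‖ - |C| - |ψ 0| ≤ ψ x := by
    intro x
    have habs : ∀ l, ε / 2 * |x l| ≤ ψ x + C := by
      intro l
      have h1 := hcoord x l (ε / 2) (by rw [abs_of_pos (half_pos hε)]; linarith)
      have h2 := hcoord x l (-(ε / 2)) (by rw [abs_neg, abs_of_pos (half_pos hε)]; linarith)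
      rcases abs_cases (x l) with h | h <;> rw [h.1] <;> linarith
    rcases isEmpty_or_nonempty (Fin n) with hn | hn
    · rw [Subsingleton.elim x 0, norm_zero]
      have := neg_abs_le (ψ 0)
      have := abs_nonneg C
      linarith
    · have h3 : ‖x‖ ≤ (ψ x + C) / (ε / 2) := by
        refine (pi_norm_le_iff_of_nonempty _).2 fun l => ?_
        rw [Real.norm_eq_abs, le_div_iff₀ (half_pos hε), mul_comm]
        exact habs l
      rw [le_div_iff₀ (half_pos hε), mul_comm] at h3
      have := abs_nonneg (ψ 0)
      have := le_abs_self C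
      linarith
  have hcoer : Filter.Tendsto ψ (Filter.cocompact _) Filter.atTop := by
    refine Filter.tendsto_atTop_mono hlower ?_
    simp only [sub_eq_add_neg, add_assoc]
    exact Filter.tendsto_atTop_add_const_right _ _
      ((tendsto_norm_cocompact_atTop).const_mul_atTop (half_pos hε))
  have hcont : Continuous ψ := continuous_iff_continuousAt.2 fun x => (hψ x).continuousAt
  obtain ⟨x, hx⟩ := hcont.exists_forall_le hcoer
  have hzero := (show IsLocalMin ψ x from Filter.Eventually.of_forall hx).hasFDerivAt_eq_zero (hψ x)
  refine ⟨x, ?_⟩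
  ext l
  have h1 := congrArg (fun f => f (Pi.single l 1)) hzero
  simp only [sub_apply, sum_apply, dotCLM_apply, dotProduct_single, mul_one, zero_apply] at h1
  simp only [Finset.sum_apply]
  linarith

lemma sum_convexHull_coe (B : Fin n → Finset (Fin n → ℝ)) (S : Finset (Fin n)) :
    ∃ P : Set (Fin n → ℝ), P.Finite ∧
      ∑ i ∈ S, convexHull ℝ (B i : Set (Fin n → ℝ)) = convexHull ℝ P := by
  classical
  refine ⟨∑ i ∈ S, (B i : Set (Fin n → ℝ)), ?_, (convexHull_sum _ _).symm⟩
  rw [← Finset.coe_sum]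
  exact Finset.finite_toSet _

/-- The determinant of the Hessian of the potential integrates to the volume of the Minkowski
sum. -/
lemma lintegral_det_sum_gibbsHess (hB : ∀ i, (B i).Nonempty) (hc : ∀ i a, 0 < c i a)
    (S : Finset (Fin n)) :
    ∫⁻ x, ENNReal.ofReal (∑ i ∈ S, gibbsHess (B i) (c i) x).det =
      volume (∑ i ∈ S, convexHull ℝ (B i : Set (Fin n → ℝ))) := by
  by_cases hS : ∀ v ≠ 0, ∃ i ∈ S, ∃ a ∈ B i, ∃ b ∈ B i, a ⬝ᵥ v ≠ b ⬝ᵥ v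
  · have h1 := lintegral_abs_det_fderiv_eq_addHaar_image volume MeasurableSet.univ
      (fun x _ => (hasFDerivAt_sum_momentMap hB hc S x).hasFDerivWithinAt)
      (injective_sum_momentMap hB hc hS).injOn
    simp only [LinearMap.det_toContinuousLinearMap, LinearMap.det_toLin', Set.image_univ,
      Measure.restrict_univ, abs_of_nonneg (posSemidef_sum_gibbsHess hB hc S _).det_nonneg] at h1
    rw [h1]
    obtain ⟨P, -, hP⟩ := sum_convexHull_coe B S
    refine le_antisymm (measure_mono ?_) ?_
    · rintro _ ⟨x, rfl⟩
      exact Set.finsetSum_mem_finsetSum _ _ _ fun i _ => momentMap_mem_convexHull (hB i) (hc i) x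
    · have h2 := interior_subset_range_sum_momentMap hB hc S
      have h3 : volume (frontier (∑ i ∈ S, convexHull ℝ (B i : Set (Fin n → ℝ)))) = 0 := by
        rw [hP]
        exact (convex_convexHull ℝ P).addHaar_frontier volume
      calc volume (∑ i ∈ S, convexHull ℝ (B i : Set (Fin n → ℝ)))
          ≤ volume (interior (∑ i ∈ S, convexHull ℝ (B i : Set (Fin n → ℝ))) ∪
              frontier (∑ i ∈ S, convexHull ℝ (B i : Set (Fin n → ℝ)))) := by
            refine measure_mono fun x hx => ?_
            rw [← closure_eq_interior_union_frontier]
            exact subset_closure hx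
        _ ≤ _ := (measure_union_le _ _).trans (by rw [h3, add_zero]; exact measure_mono h2)
  · push Not at hS
    obtain ⟨v, hv, hS⟩ := hS
    have hdet : ∀ x, (∑ i ∈ S, gibbsHess (B i) (c i) x).det = 0 := by
      intro x
      refine Matrix.exists_mulVec_eq_zero_iff.1 ⟨v, hv, ?_⟩
      rw [Matrix.sum_mulVec]
      refine Finset.sum_eq_zero fun i hi => ?_
      rw [gibbsHess_mulVec]
      refine Finset.sum_eq_zero fun t ht => ?_
      rw [Finset.mem_product] at ht
      rw [sub_dotProduct, hS i hi _ ht.1 _ ht.2, sub_self, mul_zero, zero_smul]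
    simp only [hdet, ENNReal.ofReal_zero, lintegral_zero]
    symm
    choose q hq using hB
    let Q : AffineSubspace ℝ (Fin n → ℝ) :=
      AffineSubspace.mk' (∑ i ∈ S, q i) (LinearMap.ker (dotCLM v).toLinearMap)
    have hQ : Q ≠ ⊤ := by
      intro h
      have h1 : LinearMap.ker (dotCLM v).toLinearMap = ⊤ := by
        rw [← AffineSubspace.direction_mk' (∑ i ∈ S, q i) (LinearMap.ker (dotCLM v).toLinearMap)]
        change Q.direction = ⊤
        rw [h, AffineSubspace.direction_top]
      have h2 : v ∈ LinearMap.ker (dotCLM v).toLinearMap := h1 ▸ Submodule.mem_top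
      rw [LinearMap.mem_ker] at h2
      exact hv (dotProduct_self_eq_zero.1 ((dotCLM_apply v v).symm.trans h2))
    refine measure_mono_null (fun p hp => ?_) (Measure.addHaar_affineSubspace volume Q hQ)
    obtain ⟨r, hr, rfl⟩ := (Set.mem_finsetSum _ _ _).1 hp
    rw [SetLike.mem_coe, AffineSubspace.mem_mk', LinearMap.mem_ker]
    change dotCLM v (∑ i ∈ S, r i - ∑ i ∈ S, q i) = 0
    rw [map_sub, map_sum, map_sum, sub_eq_zero]
    refine Finset.sum_congr rfl fun i hi => ?_
    have hlin : IsLinearMap ℝ fun p : Fin n → ℝ => dotCLM v p :=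
      ⟨map_add (dotCLM v), map_smul (dotCLM v)⟩
    refine convexHull_min (fun a ha => ?_) (convex_hyperplane hlin (dotCLM v (q i))) (hr hi)
    rw [Set.mem_ofPred_eq, dotCLM_apply, dotCLM_apply, dotProduct_comm, dotProduct_comm v]
    exact hS i hi a ha (q i) (hq i)

lemma integrable_det_sum_gibbsHess (hB : ∀ i, (B i).Nonempty) (hc : ∀ i a, 0 < c i a)
    (S : Finset (Fin n)) :
    Integrable fun x => (∑ i ∈ S, gibbsHess (B i) (c i) x).det := by
  refine ⟨Continuous.aestronglyMeasurable ?_, ?_⟩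
  · exact (continuous_finsetSum _ fun i _ => continuous_gibbsHess (hB i) (hc i)).matrix_det
  · rw [hasFiniteIntegral_iff_ofReal (Filter.Eventually.of_forall fun x =>
      (posSemidef_sum_gibbsHess hB hc S x).det_nonneg), lintegral_det_sum_gibbsHess hB hc S]
    obtain ⟨P, hPf, hP⟩ := sum_convexHull_coe B S
    rw [hP]
    exact (hPf.isCompact_convexHull ℝ).measure_lt_top

lemma integrable_mixedDet_gibbsHess (hB : ∀ i, (B i).Nonempty) (hc : ∀ i a, 0 < c i a) :
    Integrable fun x => mixedDet fun i => gibbsHess (B i) (c i) x :=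
  integrable_finsetSum _ fun S _ => (integrable_det_sum_gibbsHess hB hc S).const_mul _

/-- The mixed volume of polytopes is the integral of the mixed determinant of the Hessians, for
every choice of positive coefficients. -/
lemma mixedVol_eq_integral_mixedDet (hB : ∀ i, (B i).Nonempty) (hc : ∀ i a, 0 < c i a) :
    mixedVol n (fun i => convexHull ℝ (B i : Set (Fin n → ℝ))) =
      ∫ x, mixedDet fun i => gibbsHess (B i) (c i) x := by
  unfold mixedVol mixedDet
  rw [integral_finsetSum _ fun S _ => (integrable_det_sum_gibbsHess hB hc S).const_mul _]
  refine Finset.sum_congr rfl fun S _ => ?_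
  rw [integral_const_mul, integral_eq_lintegral_of_nonneg_ae (Filter.Eventually.of_forall fun x =>
      (posSemidef_sum_gibbsHess hB hc S x).det_nonneg)
    (integrable_det_sum_gibbsHess hB hc S).aestronglyMeasurable,
    lintegral_det_sum_gibbsHess hB hc S]

/-- The set of pairs of exponents, one pair for each member of the system. -/
noncomputable def pairChoices (B : Fin n → Finset (Fin n → ℝ)) :
    Finset (Fin n → (Fin n → ℝ) × (Fin n → ℝ)) :=
  Fintype.piFinset fun i => B i ×ˢ B i

lemma mixedDet_gibbsHess (B : Fin n → Finset (Fin n → ℝ)) (c : Fin n → (Fin n → ℝ) → ℝ)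
    (x : Fin n → ℝ) : mixedDet (fun i => gibbsHess (B i) (c i) x) =
      ∑ f ∈ pairChoices B, (∏ i, pairWeight (B i) (c i) x (f i)) *
        (Matrix.of fun i => (f i).1 - (f i).2).det ^ 2 := by
  classical
  exact mixedDet_sum_vecMulVec (fun i => B i ×ˢ B i) (fun i t => pairWeight (B i) (c i) x t)
    fun _ t => t.1 - t.2

/-- If the polytopes contain linearly independent segments, their mixed volume is positive. -/
lemma mixedVol_pos (hB : ∀ i, (B i).Nonempty)
    (h : ∃ f ∈ pairChoices B, (Matrix.of fun i => (f i).1 - (f i).2).det ≠ 0) :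
    0 < mixedVol n (fun i => convexHull ℝ (B i : Set (Fin n → ℝ))) := by
  have hc : ∀ (i : Fin n) (a : Fin n → ℝ), (0 : ℝ) < (fun _ _ => 1 : Fin n → (Fin n → ℝ) → ℝ) i a :=
    fun _ _ => one_pos
  obtain ⟨f, hf, hdet⟩ := h
  have hpos : ∀ x, 0 < mixedDet fun i => gibbsHess (B i) (fun _ => 1) x := by
    intro x
    rw [mixedDet_gibbsHess B (fun _ _ => 1)]
    have hw : ∀ f : Fin n → (Fin n → ℝ) × (Fin n → ℝ),
        0 < ∏ i, pairWeight (B i) (fun _ => 1) x (f i) := fun f =>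
      Finset.prod_pos fun i _ => pairWeight_pos (hB i) (hc i) x _
    exact Finset.sum_pos' (fun f _ => mul_nonneg (hw f).le (sq_nonneg _))
      ⟨f, hf, mul_pos (hw f) (sq_pos_of_ne_zero hdet)⟩
  rw [mixedVol_eq_integral_mixedDet hB hc, integral_pos_iff_support_of_nonneg
    (fun x => (hpos x).le) (integrable_mixedDet_gibbsHess hB hc)]
  have : (Function.support fun x => mixedDet fun i => gibbsHess (B i) (fun _ => 1) x) =
      Set.univ := Set.eq_univ_of_forall fun x => (hpos x).ne'
  rw [this]
  exact isOpen_univ.measure_pos volume Set.univ_nonempty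

end System

lemma integrable_exp_neg_mul_norm {E : Type*} [NormedAddCommGroup E] [NormedSpace ℝ E]
    [FiniteDimensional ℝ E] [MeasurableSpace E] [BorelSpace E] (μ : Measure E)
    [μ.IsAddHaarMeasure] {δ : ℝ} (hδ : 0 < δ) :
    Integrable (fun x : E => Real.exp (-(δ * ‖x‖))) μ := by
  set m := Module.finrank ℝ E + 1 with hm
  have h1 : Integrable (fun x : E => (1 + ‖x‖) ^ (-(m : ℝ))) μ :=
    integrable_one_add_norm (by rw [hm]; push_cast; linarith)
  refine (h1.const_mul (Real.exp δ * m.factorial / δ ^ m)).mono'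
    (Real.continuous_exp.comp (continuous_const.mul continuous_norm).neg).aestronglyMeasurable
    (Filter.Eventually.of_forall fun x => ?_)
  have hx : 0 < 1 + ‖x‖ := by positivity
  have h2 := Real.pow_div_factorial_le_exp (δ * (1 + ‖x‖)) (by positivity) m
  rw [Real.norm_of_nonneg (Real.exp_pos _).le, Real.rpow_neg hx.le, Real.rpow_natCast]
  have h3 : Real.exp (-(δ * ‖x‖)) = Real.exp δ / Real.exp (δ * (1 + ‖x‖)) := by
    rw [← Real.exp_sub]
    congr 1
    ring
  calc Real.exp (-(δ * ‖x‖)) = Real.exp δ / Real.exp (δ * (1 + ‖x‖)) := h3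
    _ ≤ Real.exp δ / ((δ * (1 + ‖x‖)) ^ m / m.factorial) :=
        div_le_div_of_nonneg_left (Real.exp_pos _).le (by positivity) h2
    _ = _ := by
        rw [mul_pow]
        field_simp

lemma exists_mul_norm_le_of_homogeneous {E : Type*} [NormedAddCommGroup E] [NormedSpace ℝ E]
    [FiniteDimensional ℝ E] {γ : E → ℝ} (hcont : Continuous γ)
    (hhom : ∀ (r : ℝ) x, 0 ≤ r → γ (r • x) = r * γ x) (hpos : ∀ x ≠ 0, 0 < γ x) :
    ∃ δ > 0, ∀ x, δ * ‖x‖ ≤ γ x := by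
  have h0 : γ 0 = 0 := by simpa using hhom 0 0 le_rfl
  rcases subsingleton_or_nontrivial E with hE | hE
  · refine ⟨1, one_pos, fun x => ?_⟩
    rw [Subsingleton.elim x 0, h0, norm_zero, mul_zero]
  · obtain ⟨y, hy, hmin⟩ := (isCompact_sphere (0 : E) 1).exists_isMinOn
      (NormedSpace.sphere_nonempty.2 zero_le_one) hcont.continuousOn
    have hy0 : y ≠ 0 := Metric.ne_of_mem_sphere hy one_ne_zero
    refine ⟨γ y, hpos y hy0, fun x => ?_⟩
    rcases eq_or_ne x 0 with rfl | hx
    · rw [h0, norm_zero, mul_zero]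
    · have hnx : ‖x‖ ≠ 0 := norm_ne_zero_iff.2 hx
      have h1 : γ y ≤ γ (‖x‖⁻¹ • x) := hmin (by
        rw [mem_sphere_zero_iff_norm, norm_smul, norm_inv, norm_norm, inv_mul_cancel₀ hnx])
      have h2 : γ x = ‖x‖ * γ (‖x‖⁻¹ • x) := by
        rw [← hhom _ _ (norm_nonneg x), smul_smul, mul_inv_cancel₀ hnx, one_smul]
      rw [h2, mul_comm]
      exact mul_le_mul_of_nonneg_left h1 (norm_nonneg x)

section Vanishing

variable {n : ℕ} {B : Fin n → Finset (Fin n → ℝ)}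

lemma gibbs_le_exp_sub_sup' {s : Finset (Fin n → ℝ)} {c : (Fin n → ℝ) → ℝ} (hs : s.Nonempty)
    (hc : ∀ a, c a = 1) (x a : Fin n → ℝ) :
    gibbs s c x a ≤ Real.exp (a ⬝ᵥ x - s.sup' hs fun b => b ⬝ᵥ x) := by
  obtain ⟨b, hb, hbs⟩ := Finset.exists_mem_eq_sup' hs fun b => b ⬝ᵥ x
  rw [hbs]
  simpa [hc] using gibbs_le_div (fun a => by rw [hc]; exact one_pos) x a hb (c := c)

lemma pairWeight_le_mul {s : Finset (Fin n → ℝ)} {c : (Fin n → ℝ) → ℝ} (hs : s.Nonempty)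
    (hc : ∀ a, 0 < c a) (x : Fin n → ℝ) (t : (Fin n → ℝ) × (Fin n → ℝ)) :
    pairWeight s c x t ≤ gibbs s c x t.1 * gibbs s c x t.2 :=
  half_le_self (mul_pos (gibbs_pos hs hc x _) (gibbs_pos hs hc x _)).le

lemma pairWeight_le_left {s : Finset (Fin n → ℝ)} {c : (Fin n → ℝ) → ℝ} (hs : s.Nonempty)
    (hc : ∀ a, 0 < c a) (x : Fin n → ℝ) {t : (Fin n → ℝ) × (Fin n → ℝ)} (ht : t ∈ s ×ˢ s) :
    pairWeight s c x t ≤ gibbs s c x t.1 :=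
  (pairWeight_le_mul hs hc x t).trans (mul_le_of_le_one_right (gibbs_pos hs hc x _).le
    (gibbs_le_one hs hc x (Finset.mem_product.1 ht).2))

lemma pairWeight_le_right {s : Finset (Fin n → ℝ)} {c : (Fin n → ℝ) → ℝ} (hs : s.Nonempty)
    (hc : ∀ a, 0 < c a) (x : Fin n → ℝ) {t : (Fin n → ℝ) × (Fin n → ℝ)} (ht : t ∈ s ×ˢ s) :
    pairWeight s c x t ≤ gibbs s c x t.2 :=
  (pairWeight_le_mul hs hc x t).trans (mul_le_of_le_one_left (gibbs_pos hs hc x _).le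
    (gibbs_le_one hs hc x (Finset.mem_product.1 ht).1))

lemma pairWeight_le_one {s : Finset (Fin n → ℝ)} {c : (Fin n → ℝ) → ℝ} (hs : s.Nonempty)
    (hc : ∀ a, 0 < c a) (x : Fin n → ℝ) {t : (Fin n → ℝ) × (Fin n → ℝ)} (ht : t ∈ s ×ˢ s) :
    pairWeight s c x t ≤ 1 :=
  (pairWeight_le_left hs hc x ht).trans (gibbs_le_one hs hc x (Finset.mem_product.1 ht).1)

/-- Away from the common tropical hypersurfaces the product of pair weights decays exponentially,
uniformly in the coefficients of the member `i₀`. -/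
lemma exists_prod_pairWeight_le_exp (hB : ∀ i, (B i).Nonempty) (i₀ : Fin n)
    (htrop : ∀ x, (∀ i ≠ i₀, x ∈ tropHS n (B i)) → x = 0)
    {f : Fin n → (Fin n → ℝ) × (Fin n → ℝ)} (hf : f ∈ pairChoices B)
    (hne : ∀ i, (f i).1 ≠ (f i).2) :
    ∃ δ > 0, ∀ c : Fin n → (Fin n → ℝ) → ℝ, (∀ i a, 0 < c i a) → (∀ i ≠ i₀, ∀ a, c i a = 1) →
      ∀ x, ∏ i, pairWeight (B i) (c i) x (f i) ≤ Real.exp (-(δ * ‖x‖)) := by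
  have hfB : ∀ i, f i ∈ B i ×ˢ B i := Fintype.mem_piFinset.1 hf
  let M : Fin n → (Fin n → ℝ) → ℝ := fun i x => (B i).sup' (hB i) fun b => b ⬝ᵥ x
  have hM : ∀ i x, ∀ a ∈ B i, a ⬝ᵥ x ≤ M i x := fun i x a ha =>
    Finset.le_sup' (fun b => b ⬝ᵥ x) ha
  let γ : (Fin n → ℝ) → ℝ := fun x => ∑ i ∈ Finset.univ.erase i₀,
    ((M i x - (f i).1 ⬝ᵥ x) + (M i x - (f i).2 ⬝ᵥ x))
  have hnn : ∀ i x, 0 ≤ M i x - (f i).1 ⬝ᵥ x ∧ 0 ≤ M i x - (f i).2 ⬝ᵥ x := fun i x =>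
    ⟨sub_nonneg.2 (hM i x _ (Finset.mem_product.1 (hfB i)).1),
      sub_nonneg.2 (hM i x _ (Finset.mem_product.1 (hfB i)).2)⟩
  have hcont : Continuous γ := by
    refine continuous_finsetSum _ fun i _ => ?_
    have hMc : Continuous (M i) :=
      Continuous.finset_sup'_apply (hB i) fun b _ => continuous_dotProduct_left b
    exact (hMc.sub (continuous_dotProduct_left _)).add (hMc.sub (continuous_dotProduct_left _))
  have hhom : ∀ (r : ℝ) x, 0 ≤ r → γ (r • x) = r * γ x := by
    intro r x hr
    have hMr : ∀ i, M i (r • x) = r * M i x := by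
      intro i
      simp only [M, dotProduct_smul, smul_eq_mul]
      exact (Finset.mul₀_sup' hr (fun b => b ⬝ᵥ x) (B i) (hB i)).symm
    simp only [γ, hMr, dotProduct_smul, smul_eq_mul, Finset.mul_sum]
    refine Finset.sum_congr rfl fun i _ => ?_
    ring
  have hpos : ∀ x ≠ 0, 0 < γ x := by
    intro x hx
    by_contra hle
    refine hx (htrop x fun i hi => ?_)
    have hsum : γ x = 0 := le_antisymm (not_lt.1 hle)
      (Finset.sum_nonneg fun i _ => add_nonneg (hnn i x).1 (hnn i x).2)
    have h1 := (Finset.sum_eq_zero_iff_of_nonneg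
      fun i _ => add_nonneg (hnn i x).1 (hnn i x).2).1 hsum i
        (Finset.mem_erase.2 ⟨hi, Finset.mem_univ i⟩)
    have h2 := hnn i x
    refine ⟨(f i).1, (Finset.mem_product.1 (hfB i)).1, (f i).2,
      (Finset.mem_product.1 (hfB i)).2, hne i, fun b hb => ?_, ?_⟩
    · change b ⬝ᵥ x ≤ (f i).1 ⬝ᵥ x
      linarith [hM i x b hb]
    · change (f i).1 ⬝ᵥ x = (f i).2 ⬝ᵥ x
      linarith
  obtain ⟨δ, hδ, hδγ⟩ := exists_mul_norm_le_of_homogeneous hcont hhom hpos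
  refine ⟨δ, hδ, fun c hc hc1 x => ?_⟩
  rw [← Finset.mul_prod_erase _ _ (Finset.mem_univ i₀)]
  calc _ ≤ 1 * ∏ i ∈ Finset.univ.erase i₀,
        Real.exp (-((M i x - (f i).1 ⬝ᵥ x) + (M i x - (f i).2 ⬝ᵥ x))) := by
        refine mul_le_mul (pairWeight_le_one (hB _) (hc _) x (hfB _)) ?_
          (Finset.prod_nonneg fun i _ => (pairWeight_pos (hB i) (hc i) x _).le) zero_le_one
        refine Finset.prod_le_prod (fun i _ => (pairWeight_pos (hB i) (hc i) x _).le) fun i hi => ?_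
        have hi' := hc1 i (Finset.ne_of_mem_erase hi)
        refine (pairWeight_le_mul (hB i) (hc i) x (f i)).trans ?_
        refine (mul_le_mul (gibbs_le_exp_sub_sup' (hB i) hi' x _)
          (gibbs_le_exp_sub_sup' (hB i) hi' x _) (gibbs_pos (hB i) (hc i) x _).le
          (Real.exp_pos _).le).trans (le_of_eq ?_)
        rw [← Real.exp_add]
        congr 1
        simp only [M]
        ring
    _ = Real.exp (-γ x) := by rw [one_mul, ← Real.exp_sum, Finset.sum_neg_distrib]
    _ ≤ _ := Real.exp_le_exp.2 (neg_le_neg (hδγ x))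

/-- If all but one of the tropical hypersurfaces already meet in at most the origin, the mixed
volume vanishes: it does not depend on the coefficients of the remaining member, and tends to `0`
as these degenerate. -/
lemma mixedVol_eq_zero (hB : ∀ i, (B i).Nonempty) (i₀ : Fin n)
    (htrop : ∀ x, (∀ i ≠ i₀, x ∈ tropHS n (B i)) → x = 0) :
    mixedVol n (fun i => convexHull ℝ (B i : Set (Fin n → ℝ))) = 0 := by
  classical
  obtain ⟨a₀, ha₀⟩ := hB i₀
  let c : ℕ → Fin n → (Fin n → ℝ) → ℝ := fun k i a =>
    if i = i₀ ∧ a ≠ a₀ then 1 / ((k : ℝ) + 1) else 1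
  have hc : ∀ k i a, 0 < c k i a := by
    intro k i a
    simp only [c]
    split_ifs <;> positivity
  have hc1 : ∀ k, ∀ i ≠ i₀, ∀ a, c k i a = 1 := fun k i hi a => by simp [c, hi]
  have hbound : ∀ f ∈ pairChoices B, ∃ δ > 0, ∀ k x,
      (∏ i, pairWeight (B i) (c k i) x (f i)) * (Matrix.of fun i => (f i).1 - (f i).2).det ^ 2 ≤
        Real.exp (-(δ * ‖x‖)) * (Matrix.of fun i => (f i).1 - (f i).2).det ^ 2 := by
    intro f hf
    by_cases hdet : (Matrix.of fun i => (f i).1 - (f i).2).det = 0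
    · exact ⟨1, one_pos, fun k x => by simp [hdet]⟩
    · have hne : ∀ i, (f i).1 ≠ (f i).2 := fun i hi =>
        hdet (Matrix.det_eq_zero_of_row_eq_zero i fun j => by simp [hi])
      obtain ⟨δ, hδ, h⟩ := exists_prod_pairWeight_le_exp hB i₀ htrop hf hne
      exact ⟨δ, hδ, fun k x => mul_le_mul_of_nonneg_right (h (c k) (hc k) (hc1 k) x) (sq_nonneg _)⟩
  choose! δ hδ hbd using hbound
  have hnn : ∀ (k : ℕ) (x : Fin n → ℝ) (f : Fin n → (Fin n → ℝ) × (Fin n → ℝ)),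
      0 ≤ (∏ i, pairWeight (B i) (c k i) x (f i)) *
      (Matrix.of fun i => (f i).1 - (f i).2).det ^ 2 := fun k x f =>
    mul_nonneg (Finset.prod_nonneg fun i _ => (pairWeight_pos (hB i) (hc k i) x _).le)
      (sq_nonneg _)
  have hlim : ∀ x, Filter.Tendsto (fun k => mixedDet fun i => gibbsHess (B i) (c k i) x)
      Filter.atTop (nhds 0) := by
    intro x
    simp only [fun k => mixedDet_gibbsHess B (c k) x]
    rw [← Finset.sum_const_zero (s := pairChoices B)]
    refine tendsto_finsetSum _ fun f hf => ?_
    have hfB : ∀ i, f i ∈ B i ×ˢ B i := Fintype.mem_piFinset.1 hf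
    by_cases hdet : (Matrix.of fun i => (f i).1 - (f i).2).det = 0
    · simp [hdet]
    · have hne : (f i₀).1 ≠ (f i₀).2 := fun hi =>
        hdet (Matrix.det_eq_zero_of_row_eq_zero i₀ fun j => by simp [hi])
      have hsmall : ∀ k b, b ≠ a₀ → gibbs (B i₀) (c k i₀) x b ≤
          1 / ((k : ℝ) + 1) * Real.exp (b ⬝ᵥ x - a₀ ⬝ᵥ x) := by
        intro k b hb
        have := gibbs_le_div (hc k i₀) x b ha₀
        simpa [c, hb] using this
      have hprod : ∀ k, ∏ i, pairWeight (B i) (c k i) x (f i) ≤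
          pairWeight (B i₀) (c k i₀) x (f i₀) := by
        intro k
        rw [← Finset.mul_prod_erase _ _ (Finset.mem_univ i₀)]
        exact mul_le_of_le_one_right (pairWeight_pos (hB _) (hc k _) x _).le
          (Finset.prod_le_one (fun i _ => (pairWeight_pos (hB i) (hc k i) x _).le)
            fun i _ => pairWeight_le_one (hB i) (hc k i) x (hfB i))
      obtain ⟨C, hC⟩ : ∃ C : ℝ, ∀ k, ∏ i, pairWeight (B i) (c k i) x (f i) ≤
          1 / ((k : ℝ) + 1) * C := by
        by_cases h1 : (f i₀).1 = a₀
        · have h2 : (f i₀).2 ≠ a₀ := fun h => hne (h1.trans h.symm)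
          exact ⟨_, fun k => (hprod k).trans
            ((pairWeight_le_right (hB _) (hc k _) x (hfB _)).trans (hsmall k _ h2))⟩
        · exact ⟨_, fun k => (hprod k).trans
            ((pairWeight_le_left (hB _) (hc k _) x (hfB _)).trans (hsmall k _ h1))⟩
      have h3 : Filter.Tendsto (fun k : ℕ => 1 / ((k : ℝ) + 1) * C *
          (Matrix.of fun i => (f i).1 - (f i).2).det ^ 2) Filter.atTop (nhds 0) := by
        simpa using (tendsto_one_div_add_atTop_nhds_zero_nat.mul_const C).mul_const
          ((Matrix.of fun i => (f i).1 - (f i).2).det ^ 2)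
      exact squeeze_zero (fun k => hnn k x f)
        (fun k => mul_le_mul_of_nonneg_right (hC k) (sq_nonneg _)) h3
  have htends := tendsto_integral_of_dominated_convergence (μ := volume)
    (F := fun k x => mixedDet fun i => gibbsHess (B i) (c k i) x) (f := fun _ => (0 : ℝ))
    (fun x => ∑ f ∈ pairChoices B, Real.exp (-(δ f * ‖x‖)) *
      (Matrix.of fun i => (f i).1 - (f i).2).det ^ 2)
    (fun k => (integrable_mixedDet_gibbsHess hB (hc k)).aestronglyMeasurable)
    (integrable_finsetSum _ fun f hf =>
      (integrable_exp_neg_mul_norm volume (hδ f hf)).mul_const _)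
    (fun k => Filter.Eventually.of_forall fun x => by
      rw [mixedDet_gibbsHess B (c k), Real.norm_of_nonneg (Finset.sum_nonneg fun f _ => hnn k x f)]
      exact Finset.sum_le_sum fun f hf => hbd f hf k x)
    (Filter.Eventually.of_forall hlim)
  simp only [← mixedVol_eq_integral_mixedDet hB (hc _), integral_zero] at htends
  exact tendsto_nhds_unique tendsto_const_nhds htends

end Vanishing

/-- The real version of the theorem, for arbitrary finite configurations in `ℝⁿ`. -/
lemma mixedVol_pos_of_trop_inter_subset {n : ℕ} (A : Fin n → Finset (Fin n → ℝ))
    (h : (⋂ i, tropHS n (A i : Set (Fin n → ℝ))) = {0}) :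
    0 < mixedVol n (fun i => convexHull ℝ (A i : Set (Fin n → ℝ))) := by
  classical
  let diffs : Finset (Fin n → ℝ) → Set (Fin n → ℝ) := fun s =>
    (fun t : (Fin n → ℝ) × (Fin n → ℝ) => t.1 - t.2) '' (s ×ˢ s : Finset _)
  have hpos : ∀ B : Fin n → Finset (Fin n → ℝ), (∀ i, (B i).Nonempty) →
      (∃ v : Fin n → Fin n → ℝ, (∀ i, v i ∈ Submodule.span ℝ (diffs (B i))) ∧
        LinearIndependent ℝ v) → 0 < mixedVol n (fun i => convexHull ℝ (B i : Set (Fin n → ℝ))) := by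
    rintro B hB ⟨v, hv, hli⟩
    obtain ⟨u, hu, hdet⟩ := exists_det_ne_zero_of_mem_span (fun i => diffs (B i)) v hv
      ((det_of_ne_zero_iff v).2 hli)
    choose f hf hfu using hu
    refine mixedVol_pos hB ⟨f, Fintype.mem_piFinset.2 fun i => Finset.mem_coe.1 (hf i), ?_⟩
    rwa [show (fun i => (f i).1 - (f i).2) = u from funext hfu]
  have hzero : ∀ i, (0 : Fin n → ℝ) ∈ tropHS n (A i : Set (Fin n → ℝ)) := fun i =>
    Set.mem_iInter.1 (h.symm.subset (Set.mem_singleton 0)) i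
  have hA : ∀ i, ∃ a ∈ A i, ∃ b ∈ A i, a ≠ b := fun i => by
    obtain ⟨a, ha, b, hb, hab, -⟩ := hzero i
    exact ⟨a, ha, b, hb, hab⟩
  have hAne : ∀ i, (A i).Nonempty := fun i => (hA i).imp fun _ ha => ha.1
  by_cases hind : ∃ v : Fin n → Fin n → ℝ, (∀ i, v i ∈ Submodule.span ℝ (diffs (A i))) ∧
      LinearIndependent ℝ v
  · exact hpos A hAne hind
  obtain ⟨I, I', i₀, v, hi₀, hi₀', hI'I, hli, hv, hspan⟩ := exists_deficient_transversal _ hind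
  exfalso
  let B : Fin n → Finset (Fin n → ℝ) := fun i => if i ∈ I then {0, v i} else A i
  have hBI : ∀ i ∈ I, B i = {0, v i} := fun i hi => if_pos hi
  have hBA : ∀ i ∉ I, B i = A i := fun i hi => if_neg hi
  have hB : ∀ i, (B i).Nonempty := by
    intro i
    by_cases hi : i ∈ I
    · rw [hBI i hi]
      exact Finset.insert_nonempty _ _
    · rw [hBA i hi]
      exact hAne i
  refine (hpos B hB ⟨v, fun i => ?_, hli⟩).ne' (mixedVol_eq_zero hB i₀ fun x hx => ?_)
  · by_cases hi : i ∈ I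
    · rw [hBI i hi]
      exact Submodule.subset_span ⟨(v i, 0), by simp, by simp⟩
    · rw [hBA i hi]
      exact hv i hi
  · suffices x ∈ ⋂ i, tropHS n (A i : Set (Fin n → ℝ)) by rwa [h] at this
    refine Set.mem_iInter.2 fun i => ?_
    by_cases hi : i ∈ I
    · have horth : Submodule.span ℝ (v '' I') ≤ LinearMap.ker (dotCLM x).toLinearMap := by
        rw [Submodule.span_le]
        rintro _ ⟨j, hj, rfl⟩
        have hjx := hx j fun hji => hi₀' (hji ▸ hj)
        rw [hBI j (hI'I hj)] at hjx
        obtain ⟨a, ha, b, hb, hab, -, heq⟩ := hjx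
        change a ⬝ᵥ x = b ⬝ᵥ x at heq
        change dotCLM x (v j) = 0
        rw [dotCLM_apply, dotProduct_comm]
        simp only [Finset.coe_insert, Finset.coe_singleton, Set.mem_insert_iff,
          Set.mem_singleton_iff] at ha hb
        rcases ha with rfl | rfl <;> rcases hb with rfl | rfl
        · exact absurd rfl hab
        · simpa using heq.symm
        · simpa using heq
        · exact absurd rfl hab
      have heq : ∀ a ∈ A i, ∀ b ∈ A i, dotp n a x = dotp n b x := by
        intro a ha b hb
        have h1 : dotCLM x (a - b) = 0 := horth (hspan i hi
          (Submodule.subset_span ⟨(a, b), Finset.mem_coe.2 (Finset.mk_mem_product ha hb), rfl⟩))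
        rw [dotCLM_apply, dotProduct_comm, sub_dotProduct] at h1
        exact sub_eq_zero.1 h1
      obtain ⟨a, ha, b, hb, hab⟩ := hA i
      exact ⟨a, ha, b, hb, hab, fun d hd => (heq d hd a ha).le, heq a ha b hb⟩
    · have := hx i fun hii => hi (hii ▸ hi₀)
      rwa [hBA i hi] at this

/-- if the intersection of the tropical hypersurfaces with zero
coefficients of `A₁,…,Aₙ ⊆ ℤⁿ` is exactly `{0}`, then the mixed volume of the
Newton polytopes is nonzero. -/
theorem mixedVol_ne_zero_of_trop_inter_singleton (n : ℕ)
    (A : Fin n → Set (Fin n → ℤ)) (hfin : ∀ i, (A i).Finite) (hne : ∀ i, (A i).Nonempty)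
    (h : (⋂ i, tropHS n ((fun v : Fin n → ℤ => fun l => ((v l : ℝ))) '' A i)) = {0}) :
    mixedVol n (fun i => convexHull ℝ ((fun v : Fin n → ℤ => fun l => ((v l : ℝ))) '' A i)) ≠ 0 := by
  have hcoe : ∀ i, (((hfin i).image fun v : Fin n → ℤ => fun l => ((v l : ℝ))).toFinset :
      Set (Fin n → ℝ)) = (fun v : Fin n → ℤ => fun l => ((v l : ℝ))) '' A i := fun i =>
    Set.Finite.coe_toFinset _
  have := mixedVol_pos_of_trop_inter_subset
    (fun i => ((hfin i).image fun v : Fin n → ℤ => fun l => ((v l : ℝ))).toFinset)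
    (by simpa only [hcoe] using h)
  simp only [hcoe] at this
  exact this.ne'
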